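/- Every symmetric Markov flow graph with at most 4 nodes per layer, all node probabilities positive, and A(t_1) < 0 admits a set T of edges separating s_0 from t_1 whose capacity is at most 100·(φ(0) − φ(N)). -/

import Mathlib

open Finset

/-- A (layered) Markov flow graph: layers `L 0, …, L N` of nodes (pairwise disjoint, nonempty),
an initial distribution `p0` on `L 0`, and transition probabilities `q` supported on pairs of
consecutive layers, with rows summing to `1`. -/
structure MarkovFlow (V : Type) [Fintype V] [DecidableEq V] where
  N : ℕ
  one_le_N : 1 ≤ N
  L : ℕ → Finset V
  layer_nonempty : ∀ l, l ≤ N → (L l).Nonempty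
  layer_disjoint : ∀ l m, l ≤ N → m ≤ N → l ≠ m → Disjoint (L l) (L m)
  p0 : V → ℝ
  p0_nonneg : ∀ u, 0 ≤ p0 u
  p0_supp : ∀ u, u ∉ L 0 → p0 u = 0
  p0_sum : ∑ u ∈ L 0, p0 u = 1
  q : V → V → ℝ
  q_nonneg : ∀ u v, 0 ≤ q u v
  q_le_one : ∀ u v, q u v ≤ 1
  q_supp : ∀ u v, q u v ≠ 0 → ∃ l, l < N ∧ u ∈ L l ∧ v ∈ L (l + 1)
  q_row : ∀ l, l < N → ∀ u ∈ L l, ∑ v ∈ L (l + 1), q u v = 1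

namespace MarkovFlow

variable {V : Type} [Fintype V] [DecidableEq V]

/-- The marginal probability `p(u) = Pr[X_l = u]`. -/
noncomputable def pm (M : MarkovFlow V) : ℕ → V → ℝ
  | 0 => M.p0
  | l + 1 => fun v => ∑ u, pm M l u * M.q u v

/-- The `d`-step transition probability from node `u`. -/
noncomputable def cond (M : MarkovFlow V) (u : V) : ℕ → V → ℝ
  | 0 => fun v => if v = u then 1 else 0
  | d + 1 => fun v => ∑ w, cond M u d w * M.q w v

/-- The joint probability `p(u,v) = Pr[X_{l₁} = u ∧ X_{l₂} = v]` (for `l₁ ≤ l₂`). -/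
noncomputable def pj (M : MarkovFlow V) (l₁ l₂ : ℕ) (u v : V) : ℝ :=
  pm M l₁ u * cond M u (l₂ - l₁) v

/-- `A(v) = Pr[X_0 = s₀ ∣ X_l = v] - 1/2 = p(s₀,v)/p(v) - 1/2`. -/
noncomputable def A (M : MarkovFlow V) (s₀ : V) (l : ℕ) (v : V) : ℝ :=
  pj M 0 l s₀ v / pm M l v - 1 / 2

/-- The potential `φ(l) = Var[A(X_l)]`. -/
noncomputable def phi (M : MarkovFlow V) (s₀ : V) (l : ℕ) : ℝ :=
  (∑ v ∈ M.L l, pm M l v * (A M s₀ l v) ^ 2) - (∑ v ∈ M.L l, pm M l v * A M s₀ l v) ^ 2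

end MarkovFlow

namespace MarkovFlow

variable {V : Type} [Fintype V] [DecidableEq V]

/-- Symmetry of a Markov flow graph: an involution of the nodes preserving each layer and the
transition probabilities, swapping `s₀` with `s₁` and `t₀` with `t₁`. -/
def Symm (M : MarkovFlow V) (s₀ s₁ t₀ t₁ : V) : Prop :=
  ∃ σ : V → V, (∀ u, σ (σ u) = u) ∧
    (∀ l, l ≤ M.N → ∀ u ∈ M.L l, σ u ∈ M.L l) ∧
    σ s₀ = s₁ ∧ σ t₀ = t₁ ∧ ∀ u v, M.q (σ u) (σ v) = M.q u v

/-- The capacity of the edge `(u,v)`, namely `p(u,v) = p(u)·q(u,v)` when `u` lies in some layer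
`l < N` (and `0` otherwise). -/
noncomputable def ecap (M : MarkovFlow V) (u v : V) : ℝ :=
  ∑ l ∈ Finset.range M.N, if u ∈ M.L l then pm M l u * M.q u v else 0

/-- `g` is a capacity-respecting flow from `s₀` to `t₁` of value `F`. -/
def IsFlow (M : MarkovFlow V) (s₀ s₁ t₀ t₁ : V) (g : V → V → ℝ) (F : ℝ) : Prop :=
  (∀ l, l < M.N → ∀ u ∈ M.L l, ∀ v ∈ M.L (l + 1),
      0 ≤ g u v ∧ g u v ≤ pm M l u * M.q u v) ∧
  (∀ v, g s₁ v = 0) ∧ (∀ u, g u t₀ = 0) ∧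
  (∀ l, 0 < l → l < M.N → ∀ w ∈ M.L l,
      ∑ u ∈ M.L (l - 1), g u w = ∑ v ∈ M.L (l + 1), g w v) ∧
  ∑ v ∈ M.L 1, g s₀ v = F

/-- A set `T` of edges separates `s₀` from `t₁`: every positive-capacity layered path from `s₀`
to `t₁` uses an edge of `T`. -/
def Separates (M : MarkovFlow V) (s₀ t₁ : V) (T : Finset (V × V)) : Prop :=
  ∀ u : ℕ → V, u 0 = s₀ → u M.N = t₁ → (∀ l, l ≤ M.N → u l ∈ M.L l) →
    (∀ l, l < M.N → 0 < pm M l (u l) * M.q (u l) (u (l + 1))) →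
    ∃ l, l < M.N ∧ (u l, u (l + 1)) ∈ T

end MarkovFlow

namespace MarkovFlow

variable {V : Type} [Fintype V] [DecidableEq V]

lemma pm_nonneg (M : MarkovFlow V) (l : ℕ) (v : V) : 0 ≤ M.pm l v := by
  induction l generalizing v with
  | zero => exact M.p0_nonneg v
  | succ l ih => exact Finset.sum_nonneg fun u _ => mul_nonneg (ih u) (M.q_nonneg u v)

lemma eq_of_mem_layer (M : MarkovFlow V) {l m : ℕ} (hl : l ≤ M.N) (hm : m ≤ M.N) {u : V}
    (hul : u ∈ M.L l) (hum : u ∈ M.L m) : l = m := by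
  by_contra h
  exact Finset.disjoint_left.mp (M.layer_disjoint l m hl hm h) hul hum

lemma q_eq_zero (M : MarkovFlow V) {l : ℕ} (hl : l < M.N) {u v : V} (hu : u ∈ M.L l)
    (hv : v ∉ M.L (l + 1)) : M.q u v = 0 := by
  by_contra h
  obtain ⟨m, hm, hum, hvm⟩ := M.q_supp u v h
  rw [M.eq_of_mem_layer hl.le hm.le hu hum] at hv
  exact hv hvm

lemma pm_eq_zero (M : MarkovFlow V) {l : ℕ} (hl : l ≤ M.N) {v : V} (hv : v ∉ M.L l) :
    M.pm l v = 0 := by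
  induction l generalizing v with
  | zero => exact M.p0_supp v hv
  | succ l ih =>
    refine Finset.sum_eq_zero fun u _ => ?_
    by_cases hu : u ∈ M.L l
    · rw [M.q_eq_zero hl hu hv, mul_zero]
    · rw [ih (by omega) hu, zero_mul]

lemma pm_succ (M : MarkovFlow V) {l : ℕ} (hl : l < M.N) (v : V) :
    M.pm (l + 1) v = ∑ u ∈ M.L l, M.pm l u * M.q u v := by
  refine (Finset.sum_subset (Finset.subset_univ _) fun u _ hu => ?_).symm
  rw [M.pm_eq_zero hl.le hu, zero_mul]

lemma pj_zero_succ (M : MarkovFlow V) (l : ℕ) (s v : V) :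
    M.pj 0 (l + 1) s v = ∑ u, M.pj 0 l s u * M.q u v := by
  simp only [pj, Nat.sub_zero, cond, Finset.mul_sum, mul_assoc]

lemma pj_zero_nonneg (M : MarkovFlow V) (l : ℕ) (s v : V) : 0 ≤ M.pj 0 l s v := by
  induction l generalizing v with
  | zero =>
    refine mul_nonneg (M.pm_nonneg 0 s) ?_
    simp only [Nat.sub_zero, cond]
    split_ifs <;> norm_num
  | succ l ih =>
    rw [pj_zero_succ]
    exact Finset.sum_nonneg fun u _ => mul_nonneg (ih u) (M.q_nonneg u v)

lemma pj_zero_add (M : MarkovFlow V) {s₀ s₁ : V} (hL0 : M.L 0 = {s₀, s₁}) (hss : s₀ ≠ s₁)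
    (l : ℕ) (v : V) : M.pj 0 l s₀ v + M.pj 0 l s₁ v = M.pm l v := by
  induction l generalizing v with
  | zero =>
    simp only [pj, pm, Nat.sub_zero, cond]
    by_cases h0 : v = s₀
    · subst h0; simp [hss]
    · by_cases h1 : v = s₁
      · subst h1; simp [h0]
      · simp [h0, h1, M.p0_supp v (by simp [hL0, h0, h1])]
  | succ l ih =>
    rw [pj_zero_succ, pj_zero_succ, ← Finset.sum_add_distrib]
    exact Finset.sum_congr rfl fun u _ => by rw [← ih u, add_mul]

lemma pj_zero_symm (M : MarkovFlow V) {s₀ s₁ : V} (hp : M.p0 s₀ = M.p0 s₁) {σ : V → V}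
    (hσ : Function.Involutive σ) (hs : σ s₀ = s₁) (hq : ∀ u v, M.q (σ u) (σ v) = M.q u v)
    (l : ℕ) (v : V) : M.pj 0 l s₁ (σ v) = M.pj 0 l s₀ v := by
  induction l generalizing v with
  | zero =>
    have : σ v = s₁ ↔ v = s₀ := by
      rw [← hs]; exact hσ.injective.eq_iff
    simp only [pj, pm, Nat.sub_zero, cond, this, hp]
  | succ l ih =>
    rw [pj_zero_succ, pj_zero_succ,
      ← Equiv.sum_comp (hσ.toPerm σ)]
    exact Finset.sum_congr rfl fun u _ => by simp [Function.Involutive.coe_toPerm, ih, hq]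

lemma A_symm (M : MarkovFlow V) {s₀ s₁ : V} (hL0 : M.L 0 = {s₀, s₁}) (hss : s₀ ≠ s₁)
    (hp : M.p0 s₀ = M.p0 s₁) {σ : V → V}
    (hσ : Function.Involutive σ) (hs : σ s₀ = s₁) (hq : ∀ u v, M.q (σ u) (σ v) = M.q u v)
    {l : ℕ} {v : V} (hv : 0 < M.pm l v) : M.A s₀ l (σ v) = -M.A s₀ l v := by
  have h1 := M.pj_zero_symm hp hσ hs hq l v
  have h2 := M.pj_zero_symm hp hσ hs hq l (σ v)
  rw [hσ] at h2
  have h3 := M.pj_zero_add hL0 hss l v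
  have h4 := M.pj_zero_add hL0 hss l (σ v)
  have h5 : M.pm l (σ v) = M.pm l v := by linarith
  rw [A, A, h5, ← h2, eq_sub_of_add_eq' h3]
  field_simp
  ring

lemma pm_mul_A (M : MarkovFlow V) (s₀ : V) {l : ℕ} {v : V} (hv : 0 < M.pm l v) :
    M.pm l v * M.A s₀ l v = M.pj 0 l s₀ v - M.pm l v / 2 := by
  rw [A]; field_simp

/-- The reverse martingale property of `A`. -/
lemma pm_mul_A_succ (M : MarkovFlow V) {s₀ s₁ : V} (hL0 : M.L 0 = {s₀, s₁}) (hss : s₀ ≠ s₁)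
    (hpos : ∀ l, l ≤ M.N → ∀ u ∈ M.L l, 0 < M.pm l u)
    {l : ℕ} (hl : l < M.N) {v : V} (hv : v ∈ M.L (l + 1)) :
    M.pm (l + 1) v * M.A s₀ (l + 1) v = ∑ u ∈ M.L l, M.pm l u * M.A s₀ l u * M.q u v := by
  have h : M.pj 0 (l + 1) s₀ v = ∑ u ∈ M.L l, M.pj 0 l s₀ u * M.q u v := by
    rw [pj_zero_succ]
    refine (Finset.sum_subset (Finset.subset_univ _) fun u _ hu => ?_).symm
    have h1 := M.pj_zero_add hL0 hss l u
    rw [M.pm_eq_zero hl.le hu] at h1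
    have h2 := M.pj_zero_nonneg l s₀ u
    have h3 := M.pj_zero_nonneg l s₁ u
    rw [show M.pj 0 l s₀ u = 0 by linarith, zero_mul]
  rw [M.pm_mul_A s₀ (hpos _ hl v hv), h, M.pm_succ hl, Finset.sum_div, ← Finset.sum_sub_distrib]
  refine Finset.sum_congr rfl fun u hu => ?_
  rw [M.pm_mul_A s₀ (hpos _ hl.le u hu)]
  ring

/-- The second moment of `A(X_l)`. -/
noncomputable def secondMoment (M : MarkovFlow V) (s₀ : V) (l : ℕ) : ℝ :=
  ∑ v ∈ M.L l, M.pm l v * M.A s₀ l v ^ 2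

lemma sum_pm_succ_mul (M : MarkovFlow V) {l : ℕ} (hl : l < M.N) (h : V → ℝ) :
    ∑ v ∈ M.L (l + 1), h v * M.pm (l + 1) v =
      ∑ u ∈ M.L l, (∑ v ∈ M.L (l + 1), M.q u v * h v) * M.pm l u := by
  simp only [M.pm_succ hl, Finset.mul_sum, Finset.sum_mul]
  rw [Finset.sum_comm]
  exact Finset.sum_congr rfl fun u _ => Finset.sum_congr rfl fun v _ => by ring

/-- The one-step loss of the `h`-weighted second moment is the `h`-weighted energy. -/
lemma weighted_loss (M : MarkovFlow V) {s₀ s₁ : V} (hL0 : M.L 0 = {s₀, s₁}) (hss : s₀ ≠ s₁)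
    (hpos : ∀ l, l ≤ M.N → ∀ u ∈ M.L l, 0 < M.pm l u)
    {l : ℕ} (hl : l < M.N) (h : V → ℝ) :
    ∑ u ∈ M.L l, (∑ v ∈ M.L (l + 1), M.q u v * h v) * M.pm l u * M.A s₀ l u ^ 2
      = ∑ v ∈ M.L (l + 1), h v * M.pm (l + 1) v * M.A s₀ (l + 1) v ^ 2
      + ∑ u ∈ M.L l, ∑ v ∈ M.L (l + 1),
          h v * (M.pm l u * M.q u v * (M.A s₀ l u - M.A s₀ (l + 1) v) ^ 2) := by
  have h1 : ∑ v ∈ M.L (l + 1), h v * M.pm (l + 1) v * M.A s₀ (l + 1) v ^ 2 =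
      ∑ u ∈ M.L l, ∑ v ∈ M.L (l + 1),
        h v * (M.pm l u * M.A s₀ l u * M.q u v) * M.A s₀ (l + 1) v := by
    rw [Finset.sum_comm]
    refine Finset.sum_congr rfl fun v hv => ?_
    rw [← Finset.sum_mul, ← Finset.mul_sum, ← M.pm_mul_A_succ hL0 hss hpos hl hv]
    ring
  have h2 : ∑ v ∈ M.L (l + 1), h v * M.pm (l + 1) v * M.A s₀ (l + 1) v ^ 2 =
      ∑ u ∈ M.L l, ∑ v ∈ M.L (l + 1),
        h v * (M.pm l u * M.q u v) * M.A s₀ (l + 1) v ^ 2 := by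
    rw [Finset.sum_comm]
    refine Finset.sum_congr rfl fun v hv => ?_
    rw [← Finset.sum_mul, ← Finset.mul_sum, ← M.pm_succ hl]
  have h3 : ∑ u ∈ M.L l, ∑ v ∈ M.L (l + 1),
          h v * (M.pm l u * M.q u v * (M.A s₀ l u - M.A s₀ (l + 1) v) ^ 2) =
      ∑ u ∈ M.L l, (∑ v ∈ M.L (l + 1), M.q u v * h v) * M.pm l u * M.A s₀ l u ^ 2
      - 2 * ∑ u ∈ M.L l, ∑ v ∈ M.L (l + 1),
        h v * (M.pm l u * M.A s₀ l u * M.q u v) * M.A s₀ (l + 1) v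
      + ∑ u ∈ M.L l, ∑ v ∈ M.L (l + 1),
        h v * (M.pm l u * M.q u v) * M.A s₀ (l + 1) v ^ 2 := by
    simp only [Finset.sum_mul, Finset.mul_sum, ← Finset.sum_sub_distrib,
      ← Finset.sum_add_distrib]
    exact Finset.sum_congr rfl fun u _ => Finset.sum_congr rfl fun v _ => by ring
  rw [h3, ← h1, ← h2]
  ring

lemma secondMoment_sub_succ (M : MarkovFlow V) {s₀ s₁ : V} (hL0 : M.L 0 = {s₀, s₁})
    (hss : s₀ ≠ s₁) (hpos : ∀ l, l ≤ M.N → ∀ u ∈ M.L l, 0 < M.pm l u)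
    {l : ℕ} (hl : l < M.N) :
    M.secondMoment s₀ l - M.secondMoment s₀ (l + 1) = ∑ u ∈ M.L l, ∑ v ∈ M.L (l + 1),
      M.pm l u * M.q u v * (M.A s₀ l u - M.A s₀ (l + 1) v) ^ 2 := by
  have h := M.weighted_loss hL0 hss hpos hl (fun _ => 1)
  simp only [mul_one, one_mul] at h
  rw [sub_eq_iff_eq_add', secondMoment, secondMoment, ← h]
  exact Finset.sum_congr rfl fun u hu => by rw [M.q_row l hl u hu, one_mul]

lemma secondMoment_succ_le (M : MarkovFlow V) {s₀ s₁ : V} (hL0 : M.L 0 = {s₀, s₁})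
    (hss : s₀ ≠ s₁) (hpos : ∀ l, l ≤ M.N → ∀ u ∈ M.L l, 0 < M.pm l u)
    {l : ℕ} (hl : l < M.N) :
    M.secondMoment s₀ (l + 1) ≤ M.secondMoment s₀ l := by
  rw [← sub_nonneg, M.secondMoment_sub_succ hL0 hss hpos hl]
  exact Finset.sum_nonneg fun u _ => Finset.sum_nonneg fun v _ =>
    mul_nonneg (mul_nonneg (M.pm_nonneg l u) (M.q_nonneg u v)) (sq_nonneg _)

lemma secondMoment_final_le (M : MarkovFlow V) {s₀ s₁ : V} (hL0 : M.L 0 = {s₀, s₁})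
    (hss : s₀ ≠ s₁) (hpos : ∀ l, l ≤ M.N → ∀ u ∈ M.L l, 0 < M.pm l u)
    {l : ℕ} (hl : l ≤ M.N) : M.secondMoment s₀ M.N ≤ M.secondMoment s₀ l :=
  Nat.decreasingInduction (motive := fun l _ => M.secondMoment s₀ M.N ≤ M.secondMoment s₀ l)
    (fun _ hk ih => ih.trans (M.secondMoment_succ_le hL0 hss hpos hk)) le_rfl hl

lemma sum_pm (M : MarkovFlow V) {l : ℕ} (hl : l ≤ M.N) : ∑ v ∈ M.L l, M.pm l v = 1 := by
  induction l with
  | zero => exact M.p0_sum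
  | succ l ih =>
    have h := M.sum_pm_succ_mul hl (fun _ => 1)
    simp only [mul_one, one_mul] at h
    rw [h, ← ih (by omega)]
    exact Finset.sum_congr rfl fun u hu => by rw [M.q_row l hl u hu, one_mul]

lemma A_zero (M : MarkovFlow V) {s₀ s₁ : V} (hss : s₀ ≠ s₁) (hp0 : M.p0 s₀ = 1 / 2) :
    M.A s₀ 0 s₀ = 1 / 2 ∧ M.A s₀ 0 s₁ = -1 / 2 := by
  constructor <;> simp [A, pj, pm, cond, hp0, hss.symm] <;> norm_num

lemma mean_A (M : MarkovFlow V) {s₀ s₁ : V} (hL0 : M.L 0 = {s₀, s₁}) (hss : s₀ ≠ s₁)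
    (hp0 : M.p0 s₀ = 1 / 2) (hp1 : M.p0 s₁ = 1 / 2)
    (hpos : ∀ l, l ≤ M.N → ∀ u ∈ M.L l, 0 < M.pm l u) {l : ℕ} (hl : l ≤ M.N) :
    ∑ v ∈ M.L l, M.pm l v * M.A s₀ l v = 0 := by
  induction l with
  | zero =>
    obtain ⟨h0, h1⟩ := M.A_zero hss hp0
    rw [hL0, Finset.sum_pair hss, h0, h1, pm, hp0, hp1]
    norm_num
  | succ l ih =>
    rw [Finset.sum_congr rfl fun v hv => M.pm_mul_A_succ hL0 hss hpos hl hv, Finset.sum_comm,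
      ← ih (by omega)]
    refine Finset.sum_congr rfl fun u hu => ?_
    rw [← Finset.mul_sum, M.q_row l hl u hu, mul_one]

lemma phi_eq_secondMoment (M : MarkovFlow V) {s₀ s₁ : V} (hL0 : M.L 0 = {s₀, s₁})
    (hss : s₀ ≠ s₁) (hp0 : M.p0 s₀ = 1 / 2) (hp1 : M.p0 s₁ = 1 / 2)
    (hpos : ∀ l, l ≤ M.N → ∀ u ∈ M.L l, 0 < M.pm l u) {l : ℕ} (hl : l ≤ M.N) :
    M.phi s₀ l = M.secondMoment s₀ l := by
  rw [phi, M.mean_A hL0 hss hp0 hp1 hpos hl, secondMoment]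
  ring

lemma secondMoment_zero (M : MarkovFlow V) {s₀ s₁ : V} (hL0 : M.L 0 = {s₀, s₁})
    (hss : s₀ ≠ s₁) (hp0 : M.p0 s₀ = 1 / 2) (hp1 : M.p0 s₁ = 1 / 2) :
    M.secondMoment s₀ 0 = 1 / 4 := by
  obtain ⟨h0, h1⟩ := M.A_zero hss hp0
  rw [secondMoment, hL0, Finset.sum_pair hss, h0, h1, pm, hp0, hp1]
  norm_num

/-- If `|A| ≥ x` throughout layer `k`, then any weight `h` on a later layer `n` that carries a
small second moment forces a loss of potential between `k` and `n`. -/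
lemma sq_mul_sum_le (M : MarkovFlow V) {s₀ s₁ : V} (hL0 : M.L 0 = {s₀, s₁})
    (hss : s₀ ≠ s₁) (hpos : ∀ l, l ≤ M.N → ∀ u ∈ M.L l, 0 < M.pm l u)
    {k n : ℕ} (hkn : k ≤ n) (hn : n ≤ M.N) {c : ℝ} (hc : ∀ u ∈ M.L k, c ≤ M.A s₀ k u ^ 2)
    (h : V → ℝ) (h0 : ∀ v, 0 ≤ h v) (h1 : ∀ v, h v ≤ 1) :
    c * ∑ v ∈ M.L n, h v * M.pm n v ≤ ∑ v ∈ M.L n, h v * M.pm n v * M.A s₀ n v ^ 2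
      + (M.secondMoment s₀ k - M.secondMoment s₀ n) := by
  induction n, hkn using Nat.le_induction generalizing h with
  | base =>
    rw [sub_self, add_zero, Finset.mul_sum]
    refine Finset.sum_le_sum fun u hu => ?_
    rw [mul_comm]
    exact mul_le_mul_of_nonneg_left (hc u hu) (mul_nonneg (h0 u) (M.pm_nonneg k u))
  | succ n _ ih =>
    set h' : V → ℝ := fun u => if u ∈ M.L n then ∑ v ∈ M.L (n + 1), M.q u v * h v else 0 with hh'
    have e : ∀ u ∈ M.L n, h' u = ∑ v ∈ M.L (n + 1), M.q u v * h v := fun u hu => if_pos hu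
    have key := ih (by omega) h'
      (fun u => by
        simp only [hh']
        split_ifs
        · exact Finset.sum_nonneg fun v _ => mul_nonneg (M.q_nonneg u v) (h0 v)
        · exact le_rfl)
      (fun u => by
        simp only [hh']
        split_ifs with hu
        · rw [← M.q_row n hn u hu]
          exact Finset.sum_le_sum fun v _ => mul_le_of_le_one_right (M.q_nonneg u v) (h1 v)
        · exact zero_le_one)
    rw [Finset.sum_congr rfl fun u hu => by rw [e u hu],
      Finset.sum_congr (s₁ := M.L n) (f := fun v => h' v * M.pm n v * M.A s₀ n v ^ 2) rfl
        fun u hu => by rw [e u hu],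
      ← M.sum_pm_succ_mul hn, M.weighted_loss hL0 hss hpos hn] at key
    have loss : ∑ u ∈ M.L n, ∑ v ∈ M.L (n + 1),
          h v * (M.pm n u * M.q u v * (M.A s₀ n u - M.A s₀ (n + 1) v) ^ 2) ≤
        M.secondMoment s₀ n - M.secondMoment s₀ (n + 1) := by
      rw [M.secondMoment_sub_succ hL0 hss hpos hn]
      exact Finset.sum_le_sum fun u _ => Finset.sum_le_sum fun v _ =>
        mul_le_of_le_one_left (mul_nonneg (mul_nonneg (M.pm_nonneg n u) (M.q_nonneg u v))
          (sq_nonneg _)) (h1 v)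
    linarith

/-- In a layer of at most four nodes with large second moment, the nodes other than an extreme
symmetric pair all have the same `|A|`. -/
lemma abs_A_eq_or_le (M : MarkovFlow V) {s₀ : V} {l : ℕ} (hl : l ≤ M.N)
    (hcard : (M.L l).card ≤ 4) {σ : V → V}
    (hσL : ∀ u ∈ M.L l, σ u ∈ M.L l)
    (hσA : ∀ u ∈ M.L l, M.A s₀ l (σ u) = -M.A s₀ l u) {r : ℝ} (hr : 0 < r)
    (hmom : r ^ 2 ≤ M.secondMoment s₀ l) {v w : V} (hv : v ∈ M.L l) (hw : w ∈ M.L l)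
    (hvr : |M.A s₀ l v| < r) : |M.A s₀ l w| = |M.A s₀ l v| ∨ r ≤ |M.A s₀ l w| := by
  obtain ⟨u, hu, hur⟩ : ∃ u ∈ M.L l, r ≤ |M.A s₀ l u| := by
    by_contra! hcon
    have : M.secondMoment s₀ l < ∑ u ∈ M.L l, M.pm l u * r ^ 2 := by
      have hlt : ∀ u ∈ M.L l, M.A s₀ l u ^ 2 < r ^ 2 := fun u hu =>
        sq_lt_sq.mpr (by rw [abs_of_pos hr]; exact hcon u hu)
      refine Finset.sum_lt_sum (fun u hu => mul_le_mul_of_nonneg_left (hlt u hu).le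
        (M.pm_nonneg l u)) ?_
      by_contra! hz
      have : ∀ u ∈ M.L l, M.pm l u = 0 := fun u hu => by
        by_contra hne
        have hp := lt_of_le_of_ne (M.pm_nonneg l u) (Ne.symm hne)
        have := hz u hu
        have := mul_lt_mul_of_pos_left (hlt u hu) hp
        linarith
      have h1 := M.sum_pm hl
      rw [Finset.sum_eq_zero this] at h1
      exact zero_ne_one h1
    rw [← Finset.sum_mul, M.sum_pm hl, one_mul] at this
    linarith
  by_contra! hcon
  obtain ⟨hne, hwr⟩ := hcon
  have habs : ∀ z ∈ M.L l, |M.A s₀ l (σ z)| = |M.A s₀ l z| := fun z hz => by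
    rw [hσA z hz, abs_neg]
  have hfix : ∀ z ∈ M.L l, σ z = z → |M.A s₀ l z| = 0 := fun z hz h => by
    have := hσA z hz
    rw [h] at this
    rw [show M.A s₀ l z = 0 by linarith, abs_zero]
  have huu : u ≠ σ u := fun h => by have := hfix u hu h.symm; linarith
  have huv : u ≠ v := fun h => by subst h; linarith
  have huw : u ≠ w := fun h => by subst h; linarith
  have hu'v : σ u ≠ v := fun h => by have := habs u hu; rw [h] at this; linarith
  have hu'w : σ u ≠ w := fun h => by have := habs u hu; rw [h] at this; linarith
  have hvw : v ≠ w := fun h => hne (by rw [h])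
  have five : ∀ z ∈ M.L l, z ≠ u → z ≠ σ u → z ≠ v → z ≠ w → False := by
    intro z hz h1 h2 h3 h4
    have hsub : ({z, u, σ u, v, w} : Finset V) ⊆ M.L l := by
      intro y hy
      simp only [Finset.mem_insert, Finset.mem_singleton] at hy
      rcases hy with rfl | rfl | rfl | rfl | rfl
      exacts [hz, hu, hσL _ hu, hv, hw]
    have h5 : ({z, u, σ u, v, w} : Finset V).card = 5 := by
      rw [Finset.card_insert_of_notMem, Finset.card_insert_of_notMem,
        Finset.card_insert_of_notMem, Finset.card_insert_of_notMem, Finset.card_singleton] <;>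
        simp [*]
    have := Finset.card_le_card hsub
    omega
  have img : ∀ z ∈ M.L l, |M.A s₀ l z| < r → σ z = v ∨ σ z = w := by
    intro z hz hzr
    by_contra! h
    refine five (σ z) (hσL z hz) ?_ ?_ h.1 h.2
    · intro h'; have := habs z hz; rw [h'] at this; linarith
    · intro h'; have := habs z hz; rw [h', habs u hu] at this; linarith
  have hv1 : σ v = v := (img v hv hvr).resolve_right fun h => hne (by rw [← h, habs v hv])
  have hw1 : σ w = w := (img w hw hwr).resolve_left fun h => hne (by rw [← h, habs w hw])
  exact hne (by rw [hfix v hv hv1, hfix w hw hw1])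

lemma ecap_eq (M : MarkovFlow V) {l : ℕ} (hl : l < M.N) {u : V} (hu : u ∈ M.L l) (v : V) :
    M.ecap u v = M.pm l u * M.q u v := by
  rw [ecap, Finset.sum_eq_single_of_mem l (Finset.mem_range.mpr hl), if_pos hu]
  intro m hm hml
  exact if_neg fun h => hml (M.eq_of_mem_layer (Finset.mem_range.mp hm).le hl.le h hu)

open Classical in
/-- The set of edges `(u, v)` out of some layer `l` satisfying `P l u v`. -/
noncomputable def edgeSet (M : MarkovFlow V) (P : ℕ → V → V → Prop) : Finset (V × V) :=
  (Finset.range M.N).biUnion fun l => (M.L l ×ˢ M.L (l + 1)).filter fun e => P l e.1 e.2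

open Classical in
lemma sum_ecap_edgeSet (M : MarkovFlow V) (P : ℕ → V → V → Prop) :
    ∑ e ∈ M.edgeSet P, M.ecap e.1 e.2 = ∑ l ∈ Finset.range M.N, ∑ u ∈ M.L l,
      ∑ v ∈ M.L (l + 1), if P l u v then M.pm l u * M.q u v else 0 := by
  rw [edgeSet, Finset.sum_biUnion]
  · refine Finset.sum_congr rfl fun l hl => ?_
    rw [Finset.sum_filter, Finset.sum_product]
    refine Finset.sum_congr rfl fun u hu => Finset.sum_congr rfl fun v _ => ?_
    rw [M.ecap_eq (Finset.mem_range.mp hl) hu]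
  · intro l hl m hm hlm
    refine Finset.disjoint_left.mpr fun e he he' => hlm ?_
    simp only [Finset.mem_filter, Finset.mem_product] at he he'
    simp only [Finset.coe_range, Set.mem_Iio] at hl hm
    exact M.eq_of_mem_layer hl.le hm.le he.1.1 he'.1.1

end MarkovFlow

/-- `FirstHit B C k n`: `n` is the first point satisfying `C` after `k`, where `(k, n]` is an
initial piece of a maximal run of points satisfying `B`. -/
def FirstHit (B C : ℕ → Prop) (k n : ℕ) : Prop :=
  k < n ∧ ¬ B k ∧ (∀ j, k < j → j ≤ n → B j) ∧ C n ∧ ∀ j, k < j → j < n → ¬ C j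

lemma exists_firstHit {B C : ℕ → Prop} (h0 : ¬ B 0) (hCB : ∀ n, C n → B n) {l : ℕ} (hl : C l) :
    ∃ k n, FirstHit B C k n ∧ n ≤ l ∧ ∀ j, n ≤ j → j ≤ l → B j := by
  classical
  have hk : ¬ B (Nat.findGreatest (fun j => ¬ B j) l) :=
    Nat.findGreatest_spec (P := fun j => ¬ B j) (Nat.zero_le l) h0
  have hkl : Nat.findGreatest (fun j => ¬ B j) l ≤ l := Nat.findGreatest_le l
  have hrun : ∀ j, Nat.findGreatest (fun j => ¬ B j) l < j → j ≤ l → B j := fun j h1 h2 =>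
    not_not.mp (Nat.findGreatest_is_greatest h1 h2)
  generalize Nat.findGreatest (fun j => ¬ B j) l = k at hk hkl hrun
  have hlk : k < l := lt_of_le_of_ne hkl fun h => hk (h ▸ hCB l hl)
  have hex : ∃ n, k < n ∧ C n := ⟨l, hlk, hl⟩
  have hfl : Nat.find hex ≤ l := Nat.find_min' hex ⟨hlk, hl⟩
  refine ⟨k, Nat.find hex, ⟨(Nat.find_spec hex).1, hk, fun j h1 h2 => hrun j h1 (h2.trans hfl),
    (Nat.find_spec hex).2, fun j h1 h2 h3 => Nat.find_min hex h2 ⟨h1, h3⟩⟩, hfl,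
    fun j h1 h2 => hrun j ((Nat.find_spec hex).1.trans_le h1) h2⟩

lemma FirstHit.unique {B C : ℕ → Prop} {k n k' n' j : ℕ} (h : FirstHit B C k n)
    (h' : FirstHit B C k' n') (hk : k ≤ j) (hn : j < n) (hk' : k' ≤ j) (hn' : j < n') :
    n = n' := by
  obtain ⟨-, hB, hrun, hC, hmin⟩ := h
  obtain ⟨-, hB', hrun', hC', hmin'⟩ := h'
  have h1 : ¬ k < k' := fun h => hB' (hrun k' h (by omega))
  have h2 : ¬ k' < k := fun h => hB (hrun' k h (by omega))
  have h3 : ¬ n < n' := fun h => hmin' n (by omega) h hC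
  have h4 : ¬ n' < n := fun h => hmin n' (by omega) h hC'
  omega

/-- Losses of a decreasing sequence over the disjoint intervals ending at first hits add up to at
most the total loss. -/
lemma sum_firstHit_le {B C : ℕ → Prop} {N : ℕ} {E m : ℕ → ℝ}
    (hE : ∀ l, l < N → E (l + 1) ≤ E l)
    (hm : ∀ k n, n ≤ N → FirstHit B C k n → m n ≤ E k - E n) (S : Finset ℕ)
    (hS : ∀ n ∈ S, n ≤ N ∧ ∃ k, FirstHit B C k n) :
    ∑ n ∈ S, m n ≤ E 0 - E N := by
  classical
  choose! hSN K hK using hS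
  have hdisj : (S : Set ℕ).PairwiseDisjoint fun n => Finset.Ico (K n) n := by
    intro n hn n' hn' hne
    refine Finset.disjoint_left.mpr fun j hj hj' => hne ?_
    rw [Finset.mem_Ico] at hj hj'
    exact (hK n hn).unique (hK n' hn') hj.1 hj.2 hj'.1 hj'.2
  calc ∑ n ∈ S, m n ≤ ∑ n ∈ S, ∑ j ∈ Finset.Ico (K n) n, (E j - E (j + 1)) := by
        refine Finset.sum_le_sum fun n hn => (hm _ n (hSN n hn) (hK n hn)).trans_eq ?_
        have := Finset.sum_Ico_sub E (hK n hn).1.le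
        rw [← neg_sub, ← this, ← Finset.sum_neg_distrib]
        exact Finset.sum_congr rfl fun j _ => by ring
    _ = ∑ j ∈ S.biUnion fun n => Finset.Ico (K n) n, (E j - E (j + 1)) :=
        (Finset.sum_biUnion hdisj).symm
    _ ≤ ∑ j ∈ Finset.range N, (E j - E (j + 1)) := by
        refine Finset.sum_le_sum_of_subset_of_nonneg (fun j hj => ?_) fun j hj _ =>
          sub_nonneg.mpr (hE j (Finset.mem_range.mp hj))
        obtain ⟨n, hn, hj⟩ := Finset.mem_biUnion.mp hj
        exact Finset.mem_range.mpr ((Finset.mem_Ico.mp hj).2.trans_le (hSN n hn))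
    _ = E 0 - E N := Finset.sum_range_sub' E N

namespace MarkovFlow

variable {V : Type} [Fintype V] [DecidableEq V]

/-- The layer `l` contains a node with `|A| < x`. -/
def HasNear (M : MarkovFlow V) (s₀ : V) (x : ℝ) (l : ℕ) : Prop :=
  l ≤ M.N ∧ ∃ v ∈ M.L l, |M.A s₀ l v| < x

/-- The edges to be cut: those along which `A` jumps by at least `1/5`, and those entering the
central nodes of a layer where `A` first gets close to `0`. -/
def CutPred (M : MarkovFlow V) (s₀ : V) (l : ℕ) (u v : V) : Prop :=
  1 / 5 ≤ |M.A s₀ l u - M.A s₀ (l + 1) v| ∨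
    (∃ k, FirstHit (M.HasNear s₀ (1 / 4)) (M.HasNear s₀ (1 / 8)) k (l + 1)) ∧
      |M.A s₀ (l + 1) v| < 1 / 4

lemma mem_edgeSet (M : MarkovFlow V) {P : ℕ → V → V → Prop} {l : ℕ} (hl : l < M.N) {u v : V}
    (hu : u ∈ M.L l) (hv : v ∈ M.L (l + 1)) (h : P l u v) : (u, v) ∈ M.edgeSet P := by
  simp only [edgeSet, Finset.mem_biUnion, Finset.mem_range, Finset.mem_filter,
    Finset.mem_product]
  exact ⟨l, hl, ⟨hu, hv⟩, h⟩

lemma separates_edgeSet_source (M : MarkovFlow V) (s₀ t₁ : V) :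
    M.Separates s₀ t₁ (M.edgeSet fun l u _ => l = 0 ∧ u = s₀) := by
  intro u h0 _ hu _
  exact ⟨0, M.one_le_N, M.mem_edgeSet M.one_le_N (hu 0 (Nat.zero_le _)) (hu 1 M.one_le_N)
    ⟨rfl, h0⟩⟩

lemma sum_ecap_edgeSet_source (M : MarkovFlow V) {s₀ : V} (hp0 : M.p0 s₀ = 1 / 2)
    (hs : s₀ ∈ M.L 0) :
    ∑ e ∈ M.edgeSet (fun l u _ => l = 0 ∧ u = s₀), M.ecap e.1 e.2 ≤ 1 / 2 := by
  classical
  rw [M.sum_ecap_edgeSet, Finset.sum_eq_single_of_mem 0 (Finset.mem_range.mpr M.one_le_N),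
    Finset.sum_eq_single_of_mem s₀ hs]
  · simp only [and_self, if_true]
    rw [← Finset.mul_sum, M.q_row 0 M.one_le_N s₀ hs, mul_one, pm, hp0]
  · intro u _ hu
    simp [hu]
  · intro l _ hl
    simp [hl]

lemma not_hasNear_zero (M : MarkovFlow V) {s₀ s₁ : V} (hL0 : M.L 0 = {s₀, s₁})
    (hss : s₀ ≠ s₁) (hp0 : M.p0 s₀ = 1 / 2) : ¬ M.HasNear s₀ (1 / 4) 0 := by
  rintro ⟨-, v, hv, hlt⟩
  obtain ⟨h0, h1⟩ := M.A_zero hss hp0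
  rw [hL0, Finset.mem_insert, Finset.mem_singleton] at hv
  rw [abs_lt] at hlt
  rcases hv with rfl | rfl <;> linarith

lemma HasNear.mono (M : MarkovFlow V) {s₀ : V} {l : ℕ} {x y : ℝ} (hxy : x ≤ y)
    (h : M.HasNear s₀ x l) : M.HasNear s₀ y l :=
  let ⟨hl, v, hv, hlt⟩ := h
  ⟨hl, v, hv, hlt.trans_le hxy⟩

/-- A path of short steps from `A = 1/2` to `A < 0` enters the centre of a first-hit layer. -/
lemma separates_cutPred (M : MarkovFlow V) {s₀ s₁ t₁ : V} (hL0 : M.L 0 = {s₀, s₁})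
    (hss : s₀ ≠ s₁) (hp0 : M.p0 s₀ = 1 / 2) (hA : M.A s₀ M.N t₁ < 0)
    (hgap : ∀ l, l ≤ M.N → ∀ v ∈ M.L l, ∀ w ∈ M.L l, |M.A s₀ l v| < 1 / 4 →
      |M.A s₀ l w| = |M.A s₀ l v| ∨ 9 / 20 ≤ |M.A s₀ l w|) :
    M.Separates s₀ t₁ (M.edgeSet (M.CutPred s₀)) := by
  intro u h0 hN hu _
  by_contra! hcon
  have hmem : ∀ l, l < M.N → ¬ M.CutPred s₀ l (u l) (u (l + 1)) := fun l hl h =>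
    hcon l hl (M.mem_edgeSet hl (hu l hl.le) (hu (l + 1) hl) h)
  have hshort : ∀ l, l < M.N → |M.A s₀ l (u l) - M.A s₀ (l + 1) (u (l + 1))| < 1 / 5 :=
    fun l hl => not_le.mp fun h => hmem l hl (Or.inl h)
  obtain ⟨l, hl, hclose⟩ : ∃ l, l ≤ M.N ∧ |M.A s₀ l (u l)| < 1 / 8 := by
    by_contra! hfar
    have : ∀ l, l ≤ M.N → 0 < M.A s₀ l (u l) := by
      intro l
      induction l with
      | zero =>
        intro _
        rw [h0, (M.A_zero hss hp0).1]
        norm_num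
      | succ l ih =>
        intro hl
        have h1 := ih (by omega)
        have h2 := hfar l (by omega)
        have h3 := hfar (l + 1) hl
        have h4 := hshort l hl
        rw [abs_of_pos h1] at h2
        rw [abs_lt] at h4
        by_contra hneg
        rw [abs_of_nonpos (not_lt.mp hneg)] at h3
        linarith
    have h := this M.N le_rfl
    rw [hN] at h
    linarith
  obtain ⟨k, n, hkn, hnl, hrun⟩ := exists_firstHit
    (M.not_hasNear_zero hL0 hss hp0) (fun n => HasNear.mono M (by norm_num))
    (show M.HasNear s₀ (1 / 8) l from ⟨hl, u l, hu l hl, hclose⟩)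
  have hcentre : |M.A s₀ n (u n)| < 1 / 4 := by
    refine Nat.decreasingInduction' (P := fun j => |M.A s₀ j (u j)| < 1 / 4)
      (fun j hjl hnj ih => ?_) hnl (by linarith)
    obtain ⟨hj, v, hv, hlt⟩ := hrun j hnj hjl.le
    rcases hgap j hj v hv (u j) (hu j hj) hlt with h | h
    · rw [h]; exact hlt
    · have h1 := hshort j (hjl.trans_le hl)
      have h2 := abs_sub_abs_le_abs_sub (M.A s₀ j (u j)) (M.A s₀ (j + 1) (u (j + 1)))
      linarith
  obtain ⟨m, rfl⟩ : ∃ m, n = m + 1 := ⟨n - 1, by have := hkn.1; omega⟩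
  exact hmem m (by omega) (Or.inr ⟨⟨k, hkn⟩, hcentre⟩)

open Classical in
/-- The mass of the centre of a first-hit layer is bounded by the loss of second moment. -/
lemma centre_mass_le (M : MarkovFlow V) {s₀ s₁ : V} (hL0 : M.L 0 = {s₀, s₁})
    (hss : s₀ ≠ s₁) (hpos : ∀ l, l ≤ M.N → ∀ u ∈ M.L l, 0 < M.pm l u)
    (hgap : ∀ l, l ≤ M.N → ∀ v ∈ M.L l, ∀ w ∈ M.L l, |M.A s₀ l v| < 1 / 4 →
      |M.A s₀ l w| = |M.A s₀ l v| ∨ 9 / 20 ≤ |M.A s₀ l w|)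
    {k n : ℕ} (hn : n ≤ M.N)
    (hkn : FirstHit (M.HasNear s₀ (1 / 4)) (M.HasNear s₀ (1 / 8)) k n) :
    3 / 64 * ∑ v ∈ M.L n, (if |M.A s₀ n v| < 1 / 4 then M.pm n v else 0) ≤
      M.secondMoment s₀ k - M.secondMoment s₀ n := by
  obtain ⟨hlt, hfar, -, ⟨-, w, hw, hw8⟩, -⟩ := hkn
  have hc : ∀ u ∈ M.L k, (1 / 4 : ℝ) ^ 2 ≤ M.A s₀ k u ^ 2 := fun u hu => by
    rw [sq_le_sq, abs_of_pos (by norm_num : (0 : ℝ) < 1 / 4)]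
    exact not_lt.mp fun h => hfar ⟨hlt.le.trans hn, u, hu, h⟩
  have key := M.sq_mul_sum_le hL0 hss hpos hlt.le hn hc
    (fun v => if |M.A s₀ n v| < 1 / 4 then 1 else 0)
    (fun v => by split_ifs <;> norm_num) (fun v => by split_ifs <;> norm_num)
  simp only [ite_mul, one_mul, zero_mul] at key
  have hsmall : ∑ v ∈ M.L n, (if |M.A s₀ n v| < 1 / 4 then M.pm n v * M.A s₀ n v ^ 2 else 0) ≤
      1 / 64 * ∑ v ∈ M.L n, (if |M.A s₀ n v| < 1 / 4 then M.pm n v else 0) := by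
    rw [Finset.mul_sum]
    refine Finset.sum_le_sum fun v hv => ?_
    split_ifs with h
    · have h8 : |M.A s₀ n v| < 1 / 8 := by
        rcases hgap n hn w hw v hv (by linarith) with h' | h' <;> linarith
      have h64 : M.A s₀ n v ^ 2 ≤ 1 / 64 := by
        rw [← sq_abs]
        nlinarith [abs_nonneg (M.A s₀ n v)]
      rw [mul_comm]
      exact mul_le_mul_of_nonneg_right h64 (M.pm_nonneg n v)
    · simp
  linarith

lemma sum_ecap_cutPred_le (M : MarkovFlow V) {s₀ s₁ : V} (hL0 : M.L 0 = {s₀, s₁})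
    (hss : s₀ ≠ s₁) (hpos : ∀ l, l ≤ M.N → ∀ u ∈ M.L l, 0 < M.pm l u)
    (hgap : ∀ l, l ≤ M.N → ∀ v ∈ M.L l, ∀ w ∈ M.L l, |M.A s₀ l v| < 1 / 4 →
      |M.A s₀ l w| = |M.A s₀ l v| ∨ 9 / 20 ≤ |M.A s₀ l w|) :
    ∑ e ∈ M.edgeSet (M.CutPred s₀), M.ecap e.1 e.2 ≤
      100 * (M.secondMoment s₀ 0 - M.secondMoment s₀ M.N) := by
  classical
  set hit : ℕ → Prop := fun n =>
    ∃ k, FirstHit (M.HasNear s₀ (1 / 4)) (M.HasNear s₀ (1 / 8)) k n with hhit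
  set mass : ℕ → ℝ := fun n =>
    ∑ v ∈ M.L n, (if |M.A s₀ n v| < 1 / 4 then M.pm n v else 0) with hmass
  have hlayer : ∀ l ∈ Finset.range M.N,
      ∑ u ∈ M.L l, ∑ v ∈ M.L (l + 1),
          (if M.CutPred s₀ l u v then M.pm l u * M.q u v else 0) ≤
        25 * (M.secondMoment s₀ l - M.secondMoment s₀ (l + 1)) +
          if hit (l + 1) then mass (l + 1) else 0 := by
    intro l hl
    rw [Finset.mem_range] at hl
    have hmass_eq : (if hit (l + 1) then mass (l + 1) else 0) = ∑ u ∈ M.L l, ∑ v ∈ M.L (l + 1),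
        if hit (l + 1) ∧ |M.A s₀ (l + 1) v| < 1 / 4 then M.pm l u * M.q u v else 0 := by
      rw [Finset.sum_comm]
      by_cases h : hit (l + 1)
      · simp only [h, if_true, true_and, hmass]
        refine Finset.sum_congr rfl fun v _ => ?_
        split_ifs
        · exact M.pm_succ hl v
        · simp
      · simp [h]
    rw [hmass_eq, M.secondMoment_sub_succ hL0 hss hpos hl, Finset.mul_sum,
      ← Finset.sum_add_distrib]
    refine Finset.sum_le_sum fun u _ => ?_
    rw [Finset.mul_sum, ← Finset.sum_add_distrib]
    refine Finset.sum_le_sum fun v _ => ?_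
    have hc := mul_nonneg (M.pm_nonneg l u) (M.q_nonneg u v)
    have hsq := mul_nonneg hc (sq_nonneg (M.A s₀ l u - M.A s₀ (l + 1) v))
    by_cases hP : M.CutPred s₀ l u v
    · rw [if_pos hP]
      rcases hP with hP | hP
      · have h25 : 1 / 25 ≤ (M.A s₀ l u - M.A s₀ (l + 1) v) ^ 2 := by
          rw [← sq_abs]
          nlinarith
        have := mul_le_mul_of_nonneg_left h25 hc
        split_ifs <;> linarith
      · rw [if_pos hP]
        linarith
    · rw [if_neg hP]
      split_ifs <;> linarith
  rw [M.sum_ecap_edgeSet]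
  refine (Finset.sum_le_sum hlayer).trans ?_
  rw [Finset.sum_add_distrib, ← Finset.mul_sum, Finset.sum_range_sub']
  have hhits := sum_firstHit_le (fun l hl => M.secondMoment_succ_le hL0 hss hpos hl)
    (fun k n hn hkn => M.centre_mass_le hL0 hss hpos hgap hn hkn)
    (((Finset.range M.N).map (addRightEmbedding 1)).filter hit) (fun n hn => by
      simp only [Finset.mem_filter, Finset.mem_map, Finset.mem_range] at hn
      obtain ⟨⟨m, hm, rfl⟩, h⟩ := hn
      exact ⟨hm, h⟩)
  rw [← Finset.mul_sum, Finset.sum_filter, Finset.sum_map] at hhits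
  simp only [addRightEmbedding_apply] at hhits
  have : 0 ≤ M.secondMoment s₀ 0 - M.secondMoment s₀ M.N :=
    sub_nonneg.mpr (M.secondMoment_final_le hL0 hss hpos (Nat.zero_le _))
  linarith

end MarkovFlow

/-- Lemma 9 of the paper, the treewidth-2 case: every symmetric Markov flow
graph with at most `4` nodes per layer, all node probabilities positive and `A(t₁) < 0` admits
a set `T` of edges separating `s₀` from `t₁` of capacity at most `100·(φ(0) − φ(N))`. -/
theorem stmt12 (V : Type) [Fintype V] [DecidableEq V]
    (M : MarkovFlow V) (s₀ s₁ t₀ t₁ : V)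
    (hL0 : M.L 0 = {s₀, s₁}) (hss : s₀ ≠ s₁)
    (hp0 : M.p0 s₀ = 1 / 2) (hp1 : M.p0 s₁ = 1 / 2)
    (hLN : M.L M.N = {t₀, t₁}) (htt : t₀ ≠ t₁)
    (hpos : ∀ l, l ≤ M.N → ∀ u ∈ M.L l, 0 < MarkovFlow.pm M l u)
    (hcard : ∀ l, l ≤ M.N → (M.L l).card ≤ 4)
    (hsym : M.Symm s₀ s₁ t₀ t₁)
    (hA : MarkovFlow.A M s₀ M.N t₁ < 0) :
    ∃ T : Finset (V × V), M.Separates s₀ t₁ T ∧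
      (∑ e ∈ T, MarkovFlow.ecap M e.1 e.2) ≤
        100 * (MarkovFlow.phi M s₀ 0 - MarkovFlow.phi M s₀ M.N) := by
  classical
  obtain ⟨σ, hσ, hσL, hs, -, hq⟩ := hsym
  rw [M.phi_eq_secondMoment hL0 hss hp0 hp1 hpos (Nat.zero_le _),
    M.phi_eq_secondMoment hL0 hss hp0 hp1 hpos le_rfl]
  by_cases hbig : 1 / 200 ≤ M.secondMoment s₀ 0 - M.secondMoment s₀ M.N
  · exact ⟨_, M.separates_edgeSet_source s₀ t₁,
      (M.sum_ecap_edgeSet_source hp0 (by simp [hL0])).trans (by linarith)⟩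
  have hmom : ∀ l, l ≤ M.N → (9 / 20 : ℝ) ^ 2 ≤ M.secondMoment s₀ l := fun l hl => by
    have h1 := M.secondMoment_final_le hL0 hss hpos hl
    have h2 := M.secondMoment_zero hL0 hss hp0 hp1
    norm_num
    linarith
  have hgap : ∀ l, l ≤ M.N → ∀ v ∈ M.L l, ∀ w ∈ M.L l, |M.A s₀ l v| < 1 / 4 →
      |M.A s₀ l w| = |M.A s₀ l v| ∨ 9 / 20 ≤ |M.A s₀ l w| := fun l hl v hv w hw hvx =>
    M.abs_A_eq_or_le hl (hcard l hl) (hσL l hl)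
      (fun u hu => M.A_symm hL0 hss (by rw [hp0, hp1]) hσ hs hq (hpos l hl u hu))
      (by norm_num) (hmom l hl) hv hw (by linarith)
  exact ⟨_, M.separates_cutPred hL0 hss hp0 hA hgap, M.sum_ecap_cutPred_le hL0 hss hpos hgap⟩
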